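/- arXiv:2605.04183 — 2 statements merged into one kernel-verified Lean document; each statement's English description precedes it below -/
import Mathlib

section
/- Let a ∈ ℝ^n be nonzero. If y is drawn uniformly from {−1,1}^n, then the probability that aᵀy ≥ ‖a‖₁·√(log n / n) is at least 1/n^C for some universal constant C. -/
theorem aux_sum (n : ℕ) (f : Fin n → Bool → ℝ) :
    ∑ y : Fin n → Bool, ∏ i, f i (y i) = ∏ i, (f i true + f i false) := by
  have h := Finset.prod_univ_sum (fun _ : Fin n => (Finset.univ : Finset Bool)) f
  simp only [Fintype.piFinset_univ, Fintype.sum_bool] at h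
  exact h.symm

theorem aux_num (n : ℕ) (hn : 2 ≤ n) (s t : ℝ) (hs : s = Real.sqrt (Real.log n / n))
    (ht : t = 1 / (4 * Real.sqrt n)) :
    0 ≤ s ∧ 0 < t ∧ s + t ≤ 1 ∧ t ^ 2 = 1 / (16 * n) ∧
      (1 + (s + t) ^ 2) ^ n ≤ (n : ℝ) ^ 3 := by
  have hn' : (2 : ℝ) ≤ n := by exact_mod_cast hn
  have hn0 : (0 : ℝ) < n := by linarith
  have hlog : 0.69 ≤ Real.log n := by
    have h1 := Real.log_le_log (by norm_num) hn'
    have h2 := Real.log_two_gt_d9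
    linarith
  have hq1 : 1 ≤ Real.sqrt n := by
    rw [Real.one_le_sqrt]; linarith
  have hs0 : 0 ≤ s := hs ▸ Real.sqrt_nonneg _
  have ht0 : 0 < t := by rw [ht]; positivity
  have ht4 : t ≤ 1 / 4 := by
    rw [ht]; apply one_div_le_one_div_of_le <;> linarith
  have ht2 : t ^ 2 = 1 / (16 * n) := by
    rw [ht, div_pow, mul_pow, Real.sq_sqrt hn0.le]; norm_num
  have hs2 : s ^ 2 = Real.log n / n := by
    rw [hs, Real.sq_sqrt]; positivity
  have hle : Real.log n / n ≤ 9 / 16 := by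
    rw [div_le_iff₀ hn0]
    have h := Real.log_le_sub_one_of_pos (x := n / 2) (by positivity)
    rw [Real.log_div hn0.ne' (by norm_num)] at h
    have := Real.log_two_lt_d9
    linarith
  have hs34 : s ≤ 3 / 4 := by nlinarith
  refine ⟨hs0, ht0, by linarith, ht2, ?_⟩
  have hd : n * (s + t) ^ 2 ≤ 3 * Real.log n := by
    have h1 : (s + t) ^ 2 ≤ 2 * (s ^ 2 + t ^ 2) := by nlinarith [sq_nonneg (s - t)]
    have h2 : n * (2 * (s ^ 2 + t ^ 2)) = 2 * Real.log n + 1 / 8 := by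
      rw [hs2, ht2]; field_simp; ring
    have h3 := mul_le_mul_of_nonneg_left h1 hn0.le
    linarith
  calc (1 + (s + t) ^ 2) ^ n ≤ (Real.exp ((s + t) ^ 2)) ^ n := by
        gcongr; linarith [Real.add_one_le_exp ((s + t) ^ 2)]
    _ = Real.exp (n * (s + t) ^ 2) := by rw [← Real.exp_nat_mul]
    _ ≤ Real.exp ((3 : ℕ) * Real.log n) := by
        apply Real.exp_le_exp.2; push_cast; exact hd
    _ = (n : ℝ) ^ 3 := by rw [Real.exp_nat_mul, Real.exp_log hn0]

open Classical in
theorem stmt12 : ∃ C : ℝ, 0 < C ∧ ∀ n : ℕ, 2 ≤ n → ∀ a : Fin n → ℝ, a ≠ 0 →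
    (2 : ℝ) ^ n / (n : ℝ) ^ C ≤
      ((Finset.univ.filter fun y : Fin n → Bool =>
        (∑ i, |a i|) * Real.sqrt (Real.log n / n) ≤
          ∑ i, a i * (if y i then (1 : ℝ) else -1)).card : ℝ) := by
  refine ⟨8, by norm_num, fun n hn a ha => ?_⟩
  obtain ⟨t, ht⟩ : ∃ t, t = 1 / (4 * Real.sqrt n) := ⟨_, rfl⟩
  generalize hs : Real.sqrt (Real.log n / n) = s
  obtain ⟨hs0, ht0, hst, ht2, hpow⟩ := aux_num n hn s t hs.symm ht
  have hn' : (2 : ℝ) ≤ n := by exact_mod_cast hn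
  have hn0 : (0 : ℝ) < n := by linarith
  set L := ∑ i, |a i| with hL
  have hLpos : 0 < L := by
    obtain ⟨j, hj⟩ := Function.ne_iff.1 ha
    exact Finset.sum_pos' (fun i _ => abs_nonneg _) ⟨j, Finset.mem_univ _, abs_pos.2 hj⟩
  set e : Bool → ℝ := fun b => if b then (1 : ℝ) else -1 with he
  have e1 : e true = 1 := by simp [he]
  have e2 : e false = -1 := by simp [he]
  have eabs : ∀ b, |e b| = 1 := by intro b; cases b <;> simp [he]
  set σ : Fin n → ℝ := fun i => if 0 ≤ a i then 1 else -1 with hσ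
  have σabs : ∀ i, |σ i| = 1 := by intro i; simp only [hσ]; split_ifs <;> simp
  have σsq : ∀ i, σ i ^ 2 = 1 := by intro i; rw [← sq_abs, σabs]; norm_num
  have aσ : ∀ i, a i * σ i = |a i| := by
    intro i; simp only [hσ]; split_ifs with h
    · rw [abs_of_nonneg h, mul_one]
    · rw [abs_of_neg (not_le.1 h)]; ring
  set d := s + t with hd
  have hd0 : 0 ≤ d := by positivity
  set X : (Fin n → Bool) → ℝ := fun y => ∑ i, a i * e (y i) with hX
  set W : (Fin n → Bool) → ℝ := fun y => ∏ i, (1 + d * σ i * e (y i)) with hW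
  have hW0 : ∀ y, 0 ≤ W y := by
    intro y
    refine Finset.prod_nonneg fun i _ => ?_
    have : |d * σ i * e (y i)| ≤ 1 := by
      rw [abs_mul, abs_mul, σabs, eabs, abs_of_nonneg hd0]; linarith
    linarith [(abs_le.1 this).1]
  have hXL : ∀ y, X y ≤ L := by
    intro y
    refine Finset.sum_le_sum fun i _ => ?_
    refine (le_abs_self _).trans ?_
    rw [abs_mul, eabs, mul_one]
  have sW : ∑ y, W y = 2 ^ n := by
    have h := aux_sum n (fun i b => 1 + d * σ i * e b)
    simp only [hW]
    rw [h, Finset.prod_congr rfl (g := fun _ => (2 : ℝ))]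
    · simp
    · intro i _; rw [e1, e2]; ring
  have sW2 : ∑ y, W y ^ 2 = 2 ^ n * (1 + d ^ 2) ^ n := by
    have h := aux_sum n (fun i b => (1 + d * σ i * e b) ^ 2)
    simp only [hW, ← Finset.prod_pow]
    rw [h, Finset.prod_congr rfl (g := fun _ => 2 * (1 + d ^ 2))]
    · simp [mul_pow]
    · intro i _; rw [e1, e2]; linear_combination 2 * d ^ 2 * σsq i
  have sWe : ∀ j, ∑ y, W y * e (y j) = 2 ^ n * (d * σ j) := by
    intro j
    have h := aux_sum n (fun i b => (1 + d * σ i * e b) * (if i = j then e b else 1))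
    simp only [Finset.prod_mul_distrib, Finset.prod_ite_eq', Finset.mem_univ, if_true] at h
    simp only [hW]
    rw [h, Finset.prod_congr rfl (g := fun i => 2 * (if i = j then d * σ i else 1))]
    · rw [Finset.prod_mul_distrib, Finset.prod_ite_eq']; simp
    · intro i _; split_ifs <;> rw [e1, e2] <;> ring
  have sWX : ∑ y, W y * X y = 2 ^ n * d * L := by
    simp only [hX, Finset.mul_sum]
    rw [Finset.sum_comm, hL, Finset.mul_sum]
    refine Finset.sum_congr rfl fun j _ => ?_
    calc ∑ y, W y * (a j * e (y j)) = a j * ∑ y, W y * e (y j) := by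
          rw [Finset.mul_sum]; exact Finset.sum_congr rfl fun y _ => by ring
      _ = 2 ^ n * d * |a j| := by rw [sWe, ← aσ]; ring
  change _ ≤ ((Finset.univ.filter fun y : Fin n → Bool => L * s ≤ X y).card : ℝ)
  set A := Finset.univ.filter fun y : Fin n → Bool => L * s ≤ X y with hA
  have key : 2 ^ n * t ≤ ∑ y ∈ A, W y := by
    have h1 : ∑ y, W y * X y ≤ ∑ y, ((if L * s ≤ X y then W y else 0) * L + W y * (L * s)) := by
      refine Finset.sum_le_sum fun y _ => ?_
      have h0 := hW0 y
      split_ifs with h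
      · have := mul_le_mul_of_nonneg_left (hXL y) h0
        have : 0 ≤ W y * (L * s) := by positivity
        linarith
      · have := mul_le_mul_of_nonneg_left (not_le.1 h).le h0
        linarith
    rw [sWX, Finset.sum_add_distrib, ← Finset.sum_mul, ← Finset.sum_mul, sW,
      ← Finset.sum_filter] at h1
    have h2 : (2 ^ n * t) * L ≤ (∑ y ∈ A, W y) * L := by
      rw [hd] at h1; linarith
    exact le_of_mul_le_mul_right h2 hLpos
  have cs : (∑ y ∈ A, W y) ^ 2 ≤ A.card * ∑ y ∈ A, W y ^ 2 := sq_sum_le_card_mul_sum_sq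
  have sub : ∑ y ∈ A, W y ^ 2 ≤ 2 ^ n * (n : ℝ) ^ 3 := by
    calc _ ≤ ∑ y, W y ^ 2 :=
          Finset.sum_le_sum_of_subset_of_nonneg (Finset.subset_univ _) fun _ _ _ => sq_nonneg _
      _ ≤ _ := by rw [sW2]; gcongr
  have h2n : (0 : ℝ) < 2 ^ n := by positivity
  have fin1 : (2 ^ n * t) ^ 2 ≤ A.card * (2 ^ n * (n : ℝ) ^ 3) :=
    (pow_le_pow_left₀ (by positivity) key 2).trans
      (cs.trans (mul_le_mul_of_nonneg_left sub (Nat.cast_nonneg _)))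
  have fin2 : 2 ^ n ≤ (A.card : ℝ) * (16 * (n : ℝ) ^ 4) := by
    rw [mul_pow, ht2, mul_one_div, div_le_iff₀ (by positivity)] at fin1
    refine le_of_mul_le_mul_left ?_ h2n
    linarith
  have h16 : (16 : ℝ) ≤ (n : ℝ) ^ 4 := by
    have := pow_le_pow_left₀ (by norm_num) hn' 4
    linarith
  have hC : (n : ℝ) ^ (8 : ℝ) = (n : ℝ) ^ 4 * (n : ℝ) ^ 4 := by
    rw [← pow_add]; exact_mod_cast Real.rpow_natCast (n : ℝ) 8
  have hpos : (0 : ℝ) < (n : ℝ) ^ 4 * (n : ℝ) ^ 4 := mul_pos (pow_pos hn0 4) (pow_pos hn0 4)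
  rw [hC, div_le_iff₀ hpos]
  exact fin2.trans (mul_le_mul_of_nonneg_left
    (mul_le_mul_of_nonneg_right h16 (pow_nonneg hn0.le 4)) (Nat.cast_nonneg _))
end

section
/- Let W ∈ ℝ^{d×n} with WWᵀ = I_d and columns satisfying ‖w_i‖₂ ≤ 2√(d/n). Then the zonotope Z = {Wx : ‖x‖_∞ ≤ 1} satisfies Vol(Z) ≥ (n/d)^{d/2}. -/
section Helpers
open Matrix MeasureTheory

/-- Row expansion of the determinant of a product. -/
lemma zono_det_expand {d n : ℕ} (A : Matrix (Fin d) (Fin n) ℝ) (B : Matrix (Fin n) (Fin d) ℝ) :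
    (A * B).det = ∑ f : Fin d → Fin n, (∏ i, A i (f i)) * (B.submatrix f id).det := by
  have h1 : (A * B) = fun i => ∑ j, A i j • B j := by
    ext i k
    simp [Matrix.mul_apply, Finset.sum_apply]
  have h2 := (Matrix.detRowAlternating (R := ℝ) (n := Fin d)).toMultilinearMap.map_sum
    (fun i j => A i j • B j)
  rw [h1]
  refine h2.trans ?_
  refine Finset.sum_congr rfl fun f _ => ?_
  refine (MultilinearMap.map_smul_univ _ _ _).trans ?_
  rfl

/-- Cauchy-Binet, summed over all functions. -/
lemma zono_cauchy_binet {d n : ℕ} (A : Matrix (Fin d) (Fin n) ℝ) (B : Matrix (Fin n) (Fin d) ℝ) :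
    (d.factorial : ℝ) * (A * B).det =
      ∑ f : Fin d → Fin n, (A.submatrix id f).det * (B.submatrix f id).det := by
  have key : ∀ σ : Equiv.Perm (Fin d), (A * B).det =
      ∑ f : Fin d → Fin n,
        ((Equiv.Perm.sign σ : ℤ) : ℝ) * (∏ i, A i (f (σ i))) * (B.submatrix f id).det := by
    intro σ
    rw [zono_det_expand]
    rw [← Equiv.sum_comp (Equiv.arrowCongr σ.symm (Equiv.refl (Fin n)))]
    refine Finset.sum_congr rfl fun f _ => ?_
    have : (B.submatrix (Equiv.arrowCongr σ.symm (Equiv.refl (Fin n)) f) id)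
        = (B.submatrix f id).submatrix σ id := by
      ext i j
      simp [Equiv.arrowCongr]
    rw [this, Matrix.det_permute]
    simp [Equiv.arrowCongr]
    ring
  have h : ∑ σ : Equiv.Perm (Fin d), (A * B).det = (d.factorial : ℝ) * (A * B).det := by
    simp [Fintype.card_perm]
  rw [← h, Finset.sum_congr rfl fun σ _ => key σ, Finset.sum_comm]
  refine Finset.sum_congr rfl fun f _ => ?_
  rw [← Matrix.det_transpose (A.submatrix id f), Matrix.det_apply' (A.submatrix id f)ᵀ,
    Finset.sum_mul]
  rfl

/-- Hadamard's inequality for columns. -/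
lemma zono_hadamard {d : ℕ} (hd : 0 < d) (M : Matrix (Fin d) (Fin d) ℝ) :
    |M.det| ≤ ∏ j, Real.sqrt (∑ i, M i j ^ 2) := by
  have : Fact (Module.finrank ℝ (EuclideanSpace ℝ (Fin d)) = d) := ⟨by simp⟩
  let b := EuclideanSpace.basisFun (Fin d) ℝ
  let o := b.toBasis.orientation
  have h := o.abs_volumeForm_apply_le (fun j => WithLp.toLp 2 (fun i => M i j))
  rw [o.volumeForm_robust' b] at h
  rw [Module.Basis.det_apply] at h
  have e : b.toBasis.toMatrix (fun j => WithLp.toLp 2 (fun i => M i j)) = M := by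
    ext i j
    simp [Module.Basis.toMatrix_apply, b]
  rw [e] at h
  refine h.trans (le_of_eq ?_)
  refine Finset.prod_congr rfl fun j _ => ?_
  simp [EuclideanSpace.norm_eq]

noncomputable def zonoG (t : ℝ) : ℝ := (2 / Real.pi) * (1 + t ^ 2)⁻¹

lemma zonoG_nonneg (t : ℝ) : 0 ≤ zonoG t := by
  have := Real.pi_pos
  unfold zonoG; positivity

lemma zonoG_cont : Continuous zonoG := by
  unfold zonoG
  have : ∀ t : ℝ, 1 + t ^ 2 ≠ 0 := fun t => by positivity
  fun_prop (disch := assumption)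

lemma zono_lintegral_prod (d : ℕ) :
    ∫⁻ z : Fin d → ℝ, ENNReal.ofReal (∏ i, zonoG (z i)) = ENNReal.ofReal (2 ^ d) := by
  have hi : Integrable zonoG := integrable_inv_one_add_sq.const_mul _
  rw [← ofReal_integral_eq_lintegral_ofReal]
  · rw [integral_fintype_prod_volume_eq_pow]
    congr 1
    simp only [Fintype.card_fin]
    congr 1
    unfold zonoG
    rw [integral_const_mul, integral_univ_inv_one_add_sq]
    field_simp
  · exact Integrable.fintype_prod (fun _ => hi)
  · exact Filter.Eventually.of_forall fun z => Finset.prod_nonneg fun i _ => zonoG_nonneg _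

lemma zono_lintegral_lin {d : ℕ} (M : Matrix (Fin d) (Fin d) ℝ) (hM : M.det ≠ 0) :
    ∫⁻ y : Fin d → ℝ, ENNReal.ofReal (∏ i, zonoG ((M *ᵥ y) i)) =
      ENNReal.ofReal (|M.det|⁻¹ * 2 ^ d) := by
  have h := Real.map_matrix_volume_pi_eq_smul_volume_pi hM
  have hmeas : Measurable fun z : Fin d → ℝ => ENNReal.ofReal (∏ i, zonoG (z i)) := by
    have := zonoG_cont
    refine ENNReal.measurable_ofReal.comp (Continuous.measurable ?_)
    fun_prop
  have h2 := lintegral_map (μ := volume) hmeas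
    (Continuous.measurable (LinearMap.continuous_on_pi (toLin' M)))
  rw [h, lintegral_smul_measure, zono_lintegral_prod] at h2
  simp only [toLin'_apply] at h2
  rw [← h2, smul_eq_mul, ← ENNReal.ofReal_mul (abs_nonneg _), abs_inv]

lemma zono_det_formula {d n : ℕ} (W : Matrix (Fin d) (Fin n) ℝ) (D : Fin n → ℝ) :
    (d.factorial : ℝ) * (W * Matrix.diagonal D * Wᵀ).det =
      ∑ f : Fin d → Fin n, (W.submatrix id f).det ^ 2 * ∏ i, D (f i) := by
  rw [zono_cauchy_binet]
  refine Finset.sum_congr rfl fun f _ => ?_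
  have h1 : (W * Matrix.diagonal D).submatrix id f =
      W.submatrix id f * Matrix.diagonal (fun i => D (f i)) := by
    ext i j
    simp
  have h2 : Wᵀ.submatrix f id = (W.submatrix id f)ᵀ := rfl
  rw [h1, h2, det_mul, det_transpose, det_diagonal]
  ring

noncomputable def zonoT {d n : ℕ} (W : Matrix (Fin d) (Fin n) ℝ) (y : Fin d → ℝ) : Fin d → ℝ :=
  W *ᵥ (fun j => (2 / Real.pi) * Real.arctan ((Wᵀ *ᵥ y) j))

lemma zonoT_inj {d n : ℕ} (W : Matrix (Fin d) (Fin n) ℝ) (hW : W * Wᵀ = 1) :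
    Function.Injective (zonoT W) := by
  intro y y' h
  have h0 : (y - y') ⬝ᵥ (zonoT W y - zonoT W y') = 0 := by rw [h]; simp
  unfold zonoT at h0
  rw [← Matrix.mulVec_sub, Matrix.dotProduct_mulVec, ← Matrix.mulVec_transpose,
    Matrix.mulVec_sub] at h0
  simp only [dotProduct, Pi.sub_apply] at h0
  have hp := Real.pi_pos
  have hmono : ∀ a b : ℝ, 0 ≤ (a - b) * (2 / Real.pi * Real.arctan a - 2 / Real.pi * Real.arctan b) ∧
      ((a - b) * (2 / Real.pi * Real.arctan a - 2 / Real.pi * Real.arctan b) = 0 → a = b) := by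
    intro a b
    have hc : 0 < 2 / Real.pi := by positivity
    rcases lt_trichotomy a b with hab | hab | hab
    · have := mul_lt_mul_of_pos_left (Real.arctan_strictMono hab) hc
      have : 0 < (a - b) * (2 / Real.pi * Real.arctan a - 2 / Real.pi * Real.arctan b) :=
        mul_pos_of_neg_of_neg (by linarith) (by linarith)
      exact ⟨this.le, fun h => absurd h this.ne'⟩
    · subst hab; simp
    · have := mul_lt_mul_of_pos_left (Real.arctan_strictMono hab) hc
      have : 0 < (a - b) * (2 / Real.pi * Real.arctan a - 2 / Real.pi * Real.arctan b) :=
        mul_pos (by linarith) (by linarith)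
      exact ⟨this.le, fun h => absurd h this.ne'⟩
  rw [Finset.sum_eq_zero_iff_of_nonneg (fun j _ => (hmono _ _).1)] at h0
  have h3 : Wᵀ *ᵥ y = Wᵀ *ᵥ y' := funext fun j => (hmono _ _).2 (h0 j (Finset.mem_univ j))
  have h4 := congrArg (fun v => W *ᵥ v) h3
  simpa [Matrix.mulVec_mulVec, hW] using h4

lemma zonoT_deriv {d n : ℕ} (W : Matrix (Fin d) (Fin n) ℝ) (y : Fin d → ℝ) :
    HasFDerivAt (zonoT W) (LinearMap.toContinuousLinearMap (toLin'
      (W * Matrix.diagonal (fun j => zonoG ((Wᵀ *ᵥ y) j)) * Wᵀ))) y := by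
  have h1 : HasFDerivAt (fun y : Fin d → ℝ => Wᵀ *ᵥ y)
      (LinearMap.toContinuousLinearMap (toLin' Wᵀ)) y :=
    (LinearMap.toContinuousLinearMap (toLin' Wᵀ)).hasFDerivAt
  have h2 : HasFDerivAt (fun u : Fin n → ℝ => fun j => (2 / Real.pi) * Real.arctan (u j))
      (LinearMap.toContinuousLinearMap (toLin'
        (Matrix.diagonal (fun j => zonoG ((Wᵀ *ᵥ y) j))))) (Wᵀ *ᵥ y) := by
    rw [hasFDerivAt_pi']
    intro j
    have ha := ((Real.hasDerivAt_arctan ((Wᵀ *ᵥ y) j)).const_mul (2 / Real.pi)).comp_hasFDerivAt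
      (Wᵀ *ᵥ y) (hasFDerivAt_apply (𝕜 := ℝ) j (Wᵀ *ᵥ y))
    refine ha.congr_fderiv ?_
    ext v
    simp [Matrix.mulVec_diagonal, zonoG, toLin'_apply]
  have h3 : HasFDerivAt (fun u : Fin n → ℝ => W *ᵥ u)
      (LinearMap.toContinuousLinearMap (toLin' W)) 
      (fun j => (2 / Real.pi) * Real.arctan ((Wᵀ *ᵥ y) j)) :=
    (LinearMap.toContinuousLinearMap (toLin' W)).hasFDerivAt
  refine ((h3.comp (Wᵀ *ᵥ y) h2).comp y h1).congr_fderiv ?_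
  ext v
  simp [toLin'_apply, Matrix.mulVec_mulVec, Matrix.mul_assoc]

lemma zono_range {d n : ℕ} (W : Matrix (Fin d) (Fin n) ℝ) :
    zonoT W '' Set.univ ⊆ {z : Fin d → ℝ | ∃ x : Fin n → ℝ, (∀ i, |x i| ≤ 1) ∧ z = W.mulVec x} := by
  rintro _ ⟨y, -, rfl⟩
  refine ⟨_, fun j => ?_, rfl⟩
  have hp := Real.pi_pos
  have h1 := Real.arctan_lt_pi_div_two ((Wᵀ *ᵥ y) j)
  have h2 := Real.neg_pi_div_two_lt_arctan ((Wᵀ *ᵥ y) j)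
  have h3 : |Real.arctan ((Wᵀ *ᵥ y) j)| ≤ Real.pi / 2 := abs_le.2 ⟨by linarith, by linarith⟩
  rw [abs_mul, abs_of_pos (by positivity : 0 < 2 / Real.pi)]
  calc _ ≤ 2 / Real.pi * (Real.pi / 2) := by gcongr
    _ = 1 := by field_simp

lemma zono_lower {d n : ℕ} (W : Matrix (Fin d) (Fin n) ℝ) (hW : W * Wᵀ = 1) (C : ℝ) (hC : 0 < C)
    (hdet : ∀ f : Fin d → Fin n, |(W.submatrix id f).det| ≤ C) :
    ENNReal.ofReal (C⁻¹ * 2 ^ d) ≤ volume (zonoT W '' Set.univ) := by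
  rw [← lintegral_abs_det_fderiv_eq_addHaar_image volume MeasurableSet.univ
    (fun y _ => (zonoT_deriv W y).hasFDerivWithinAt) (zonoT_inj W hW).injOn]
  have hfac : (0 : ℝ) < d.factorial := by exact_mod_cast d.factorial_pos
  have hint : ∀ y : Fin d → ℝ, ENNReal.ofReal |(LinearMap.toContinuousLinearMap (toLin'
      (W * Matrix.diagonal (fun j => zonoG ((Wᵀ *ᵥ y) j)) * Wᵀ))).det| =
      ∑ f : Fin d → Fin n, ENNReal.ofReal ((d.factorial : ℝ)⁻¹ * (W.submatrix id f).det ^ 2) *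
        ENNReal.ofReal (∏ i, zonoG (((W.submatrix id f)ᵀ *ᵥ y) i)) := by
    intro y
    have hdt : (LinearMap.toContinuousLinearMap (toLin'
      (W * Matrix.diagonal (fun j => zonoG ((Wᵀ *ᵥ y) j)) * Wᵀ))).det =
      ∑ f : Fin d → Fin n, ((d.factorial : ℝ)⁻¹ * (W.submatrix id f).det ^ 2) *
         (∏ i, zonoG (((W.submatrix id f)ᵀ *ᵥ y) i)) := by
      have := zono_det_formula W (fun j => zonoG ((Wᵀ *ᵥ y) j))
      rw [LinearMap.det_toContinuousLinearMap, LinearMap.det_toLin']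
      simp_rw [mul_assoc (d.factorial : ℝ)⁻¹]
      rw [← Finset.mul_sum, eq_inv_mul_iff_mul_eq₀ hfac.ne', this]
      rfl
    have hnn : ∀ f : Fin d → Fin n, 0 ≤ ((d.factorial : ℝ)⁻¹ * (W.submatrix id f).det ^ 2) *
         (∏ i, zonoG (((W.submatrix id f)ᵀ *ᵥ y) i)) := fun f =>
      mul_nonneg (by positivity) (Finset.prod_nonneg fun i _ => zonoG_nonneg _)
    rw [hdt, abs_of_nonneg (Finset.sum_nonneg fun f _ => hnn f),
      ENNReal.ofReal_sum_of_nonneg (fun f _ => hnn f)]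
    refine Finset.sum_congr rfl fun f _ => ENNReal.ofReal_mul (by positivity)
  simp_rw [hint]
  have hmeas : ∀ f : Fin d → Fin n, Measurable fun y : Fin d → ℝ =>
      ENNReal.ofReal (∏ i, zonoG (((W.submatrix id f)ᵀ *ᵥ y) i)) := by
    intro f
    have := zonoG_cont
    refine ENNReal.measurable_ofReal.comp (Continuous.measurable ?_)
    fun_prop
  rw [Measure.restrict_univ, lintegral_finsetSum _ (fun f _ => (hmeas f).const_mul _)]
  have hone : ∑ f : Fin d → Fin n, (d.factorial : ℝ)⁻¹ * (W.submatrix id f).det ^ 2 = 1 := by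
    have := zono_det_formula W (fun _ => 1)
    simp only [Matrix.diagonal_one, Matrix.mul_one, hW, det_one, Finset.prod_const_one,
      mul_one] at this
    rw [← Finset.mul_sum, ← this]
    field_simp
  calc ENNReal.ofReal (C⁻¹ * 2 ^ d) = ∑ f : Fin d → Fin n,
        ENNReal.ofReal (((d.factorial : ℝ)⁻¹ * (W.submatrix id f).det ^ 2) * (C⁻¹ * 2 ^ d)) := by
        rw [← ENNReal.ofReal_sum_of_nonneg (fun f _ => by positivity), ← Finset.sum_mul, hone,
          one_mul]
    _ ≤ _ := by
        refine Finset.sum_le_sum fun f _ => ?_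
        rw [lintegral_const_mul _ (hmeas f)]
        by_cases h0 : (W.submatrix id f).det = 0
        · simp [h0]
        · rw [zono_lintegral_lin _ (by rwa [det_transpose]), det_transpose,
            ENNReal.ofReal_mul (by positivity)]
          have := hdet f
          have h1 : 0 < |(W.submatrix id f).det| := abs_pos.2 h0
          gcongr
end Helpers

open Matrix MeasureTheory in
theorem stmt17 (d n : ℕ) (hd : 0 < d) (hn : 0 < n) (W : Matrix (Fin d) (Fin n) ℝ)
    (hW : W * W.transpose = 1)
    (hcol : ∀ j, Real.sqrt (∑ i, W i j ^ 2) ≤ 2 * Real.sqrt ((d : ℝ) / n)) :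
    ENNReal.ofReal (((n : ℝ) / d) ^ ((d : ℝ) / 2)) ≤
      volume {z : Fin d → ℝ | ∃ x : Fin n → ℝ, (∀ i, |x i| ≤ 1) ∧ z = W.mulVec x} := by
  have hd' : (0 : ℝ) < d := by exact_mod_cast hd
  have hn' : (0 : ℝ) < n := by exact_mod_cast hn
  have h := zono_lower W hW ((2 * Real.sqrt ((d : ℝ) / n)) ^ d) (by positivity) (fun f => by
    refine (zono_hadamard hd _).trans ?_
    refine (Finset.prod_le_prod (fun j _ => Real.sqrt_nonneg _) (fun j _ => hcol (f j))).trans ?_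
    simp)
  refine le_trans (le_of_eq ?_) (h.trans (measure_mono (zono_range W)))
  congr 1
  rw [mul_pow, mul_inv, mul_comm, ← mul_assoc, mul_inv_cancel₀ (by positivity), one_mul, ← inv_pow,
    ← Real.sqrt_inv, inv_div, Real.sqrt_eq_rpow, ← Real.rpow_natCast, ← Real.rpow_mul (by positivity)]
  congr 1
  ring
end
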